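/- arXiv:math/0601066 — 2 statements merged into one kernel-verified Lean document; each statement's English description precedes it below -/
import Mathlib

section
/- For every A ∈ 𝕄⁵ the identity Υ_A(Υ_A A) = tr(A²)·A holds, i.e. Υ_A² A = ⟨A,A⟩·A. (This is the defining identity Υ_v² v = g(v,v) v of an irreducible SO(3) structure, verified in the linear model.) -/
open Matrix

/-- The tensor `Υ_A B = √6 ((AB + BA)/2 − (tr(AB)/3)·I₃)`. -/
noncomputable def Ups (A B : Matrix (Fin 3) (Fin 3) ℝ) : Matrix (Fin 3) (Fin 3) ℝ :=
  Real.sqrt 6 • ((1 / 2 : ℝ) • (A * B + B * A) -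
    ((A * B).trace / 3) • (1 : Matrix (Fin 3) (Fin 3) ℝ))

/-- For every symmetric traceless `A`, the identity `Υ_A(Υ_A A) = tr(A²)·A`
holds, i.e. `Υ_A² A = ⟨A,A⟩·A` (the defining identity of an irreducible SO(3) structure). -/
theorem stmt_6 (A : Matrix (Fin 3) (Fin 3) ℝ) (hAs : Aᵀ = A) (hAt : A.trace = 0) :
    Ups A (Ups A A) = (A * A).trace • A := by
  have h6 : Real.sqrt 6 * Real.sqrt 6 = 6 := Real.mul_self_sqrt (by norm_num)
  have key : Ups A (Ups A A) = (6 : ℝ) • (A * (A * A) - ((A * A).trace / 3) • A -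
      ((A * (A * A)).trace / 3) • (1 : Matrix (Fin 3) (Fin 3) ℝ)) := by
    have h1 : Ups A A = Real.sqrt 6 • (A * A -
        ((A * A).trace / 3) • (1 : Matrix (Fin 3) (Fin 3) ℝ)) := by
      unfold Ups
      congr 2
      rw [← two_smul ℝ (A * A), smul_smul]
      norm_num
    rw [h1]
    unfold Ups
    simp only [mul_smul_comm, smul_mul_assoc, mul_sub, sub_mul, mul_one, one_mul,
      Matrix.trace_smul, Matrix.trace_sub, hAt, smul_eq_mul, mul_zero, sub_zero, mul_assoc]
    generalize Real.sqrt 6 = r at h6 ⊢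
    rw [← h6]
    module
  rw [key]
  rw [Matrix.trace_fin_three] at hAt
  have h22 : A 2 2 = -A 0 0 - A 1 1 := by linarith
  ext i j
  fin_cases i <;> fin_cases j <;>
    simp [Matrix.mul_apply, Matrix.trace_fin_three, Fin.sum_univ_three, h22] <;> ring
end

section
/- For all real numbers λ, r₁, r₂, r₃: det(λ·I₅ + r₁ ρ₅(E₁) + r₂ ρ₅(E₂) + r₃ ρ₅(E₃)) = λ⁵ + 5(r₁² + r₂² + r₃²)·λ³ + 4(r₁² + r₂² + r₃²)²·λ. In particular the coefficient of λ³ is 5·(r₁² + r₂² + r₃²), which is 5 times the corresponding coefficient for the standard 3-dimensional representation; this factor 5 is the source of the divisibility p₁ ≡ 0 mod 5 for bundles associated to the irreducible representation. -/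
open Matrix

/-- The image of `E₁` under the irreducible 5-dimensional representation `ρ₅` of `so(3)`. -/
noncomputable def rho5E1 : Matrix (Fin 5) (Fin 5) ℝ :=
  !![0, 0, 0, 0, Real.sqrt 3;
     0, 0, 1, 0, 0;
     0, -1, 0, 0, 0;
     0, 0, 0, 0, 1;
     -Real.sqrt 3, 0, 0, -1, 0]

/-- The image of `E₂` under `ρ₅`. -/
noncomputable def rho5E2 : Matrix (Fin 5) (Fin 5) ℝ :=
  !![0, 0, Real.sqrt 3, 0, 0;
     0, 0, 0, 0, 1;
     -Real.sqrt 3, 0, 0, 1, 0;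
     0, 0, -1, 0, 0;
     0, -1, 0, 0, 0]

/-- The image of `E₃` under `ρ₅`. -/
noncomputable def rho5E3 : Matrix (Fin 5) (Fin 5) ℝ :=
  !![0, 0, 0, 0, 0;
     0, 0, 0, 2, 0;
     0, 0, 0, 0, 1;
     0, -2, 0, 0, 0;
     0, 0, -1, 0, 0]

/-- For all real `λ, r₁, r₂, r₃`:
`det(λ·I₅ + r₁ρ₅(E₁) + r₂ρ₅(E₂) + r₃ρ₅(E₃))
  = λ⁵ + 5(r₁²+r₂²+r₃²)λ³ + 4(r₁²+r₂²+r₃²)²λ`.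
In particular the coefficient of `λ³` is `5(r₁²+r₂²+r₃²)`, five times the corresponding
coefficient for the standard 3-dimensional representation. -/
theorem stmt_12 (lam r₁ r₂ r₃ : ℝ) :
    (lam • (1 : Matrix (Fin 5) (Fin 5) ℝ) + r₁ • rho5E1 + r₂ • rho5E2 + r₃ • rho5E3).det =
      lam ^ 5 + 5 * (r₁ ^ 2 + r₂ ^ 2 + r₃ ^ 2) * lam ^ 3 +
        4 * (r₁ ^ 2 + r₂ ^ 2 + r₃ ^ 2) ^ 2 * lam := by
  have h3 : Real.sqrt 3 ^ 2 = 3 := Real.sq_sqrt (by norm_num)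
  have hM : lam • (1 : Matrix (Fin 5) (Fin 5) ℝ) + r₁ • rho5E1 + r₂ • rho5E2 + r₃ • rho5E3 =
      !![lam, 0, Real.sqrt 3 * r₂, 0, Real.sqrt 3 * r₁;
         0, lam, r₁, 2 * r₃, r₂;
         -(Real.sqrt 3 * r₂), -r₁, lam, r₂, r₃;
         0, -(2 * r₃), -r₂, lam, r₁;
         -(Real.sqrt 3 * r₁), -r₂, -r₃, -r₁, lam] := by
    ext i j
    fin_cases i <;> fin_cases j <;> simp [rho5E1, rho5E2, rho5E3, Matrix.one_apply] <;> ring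
  rw [hM]
  generalize Real.sqrt 3 = s at h3
  simp [Matrix.det_succ_row_zero, Fin.sum_univ_succ, Fin.succAbove]
  have h4 : s ^ 4 = 9 := by rw [show s ^ 4 = (s ^ 2) ^ 2 by ring, h3]; norm_num
  ring_nf
  simp only [h3, h4]
  ring
end
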